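/- arXiv:2504.06503 — 3 statements merged into one kernel-verified Lean document; each statement's English description precedes it below -/
import Mathlib

section
/- Let G be a k-regular directed graph on vertices v_1,…,v_n, and suppose there exist integers p_1,…,p_n ∈ [1, n−k] with p_1 ≤ ⋯ ≤ p_n, p_i ≤ i ≤ p_i + k, and out[v_i] = {v_{p_i},…,v_{p_i+k}} for all i. Then there exist real numbers x_1 < x_2 < ⋯ < x_n such that the map v_i ↦ x_i is a kNN-realization of G in ℝ. In other words, condition 1 of the block-structure observation is sufficient (as well as necessary) for an ordering to be a feasible vertex ordering. -/
/-- A strongly connected finite directed multigraph carries a positive weight which is stationary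
for the walk along its edges. Strong connectivity is expressed through predecessor-closed sets. -/
theorem exists_pos_stationary {σ ε : Type*} [Fintype σ] [Nonempty σ] [Fintype ε]
    (src tgt : ε → σ)
    (hconn : ∀ Z : Set σ, Z.Nonempty → (∀ e, tgt e ∈ Z → src e ∈ Z) → ∀ s, s ∈ Z) :
    ∃ w : σ → ℝ, (∀ s, 0 < w s) ∧
      ∀ f : σ → ℝ, ∑ e, w (src e) * (f (tgt e) - f (src e)) = 0 := by
  classical
  let A : Matrix σ σ ℝ := fun s t => ∑ e, if src e = s then
    ((if tgt e = t then 1 else 0) - (if src e = t then 1 else 0)) else 0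
  have hA (f : σ → ℝ) (s : σ) : A.mulVec f s =
      ∑ e, if src e = s then f (tgt e) - f (src e) else 0 := by
    simp only [A, Matrix.mulVec, dotProduct, Finset.sum_mul]
    rw [Finset.sum_comm]
    refine Finset.sum_congr rfl fun e _ => ?_
    split_ifs <;> simp [sub_mul, Finset.sum_sub_distrib]
  have hdet : A.det = 0 := by
    refine Matrix.exists_mulVec_eq_zero_iff.mp ⟨fun _ => 1, ?_, ?_⟩
    · intro h
      simpa using congrFun h (Classical.arbitrary σ)
    · ext s
      simp [hA]
  obtain ⟨u, hu0, hu⟩ := Matrix.exists_vecMul_eq_zero_iff.mpr hdet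
  have hstat (f : σ → ℝ) : ∑ e, u (src e) * (f (tgt e) - f (src e)) = 0 := by
    have h : u ⬝ᵥ A.mulVec f = 0 := by rw [Matrix.dotProduct_mulVec, hu, zero_dotProduct]
    simp only [dotProduct, hA, Finset.mul_sum] at h
    rw [Finset.sum_comm] at h
    simpa using h
  have hedge (e : ε) : u (src e) * ((SignType.sign (u (tgt e)) : ℝ)
      - (SignType.sign (u (src e)) : ℝ)) = 0 := by
    refine (Finset.sum_eq_zero_iff_of_nonpos fun e _ => ?_).mp
      (hstat fun s => (SignType.sign (u s) : ℝ)) e (Finset.mem_univ e)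
    rcases lt_trichotomy (u (src e)) 0 with h | h | h <;>
    rcases lt_trichotomy (u (tgt e)) 0 with h' | h' | h' <;>
    simp [h, h'] <;> linarith
  have hne (s : σ) : u s ≠ 0 := by
    intro hs
    refine hu0 (funext fun t => hconn {s | u s = 0} ⟨s, hs⟩ (fun e he => ?_) t)
    have h := hedge e
    simp only [Set.mem_ofPred_eq] at he ⊢
    by_contra hn
    simp [he, hn] at h
  by_cases hpos : ∀ s, 0 < u s
  · exact ⟨u, hpos, hstat⟩
  push Not at hpos
  have hnonpos : ∀ s, u s ≤ 0 := by
    refine hconn {s | u s ≤ 0} hpos fun e he => ?_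
    simp only [Set.mem_ofPred_eq] at he ⊢
    by_contra! hn
    have h := hedge e
    rcases he.lt_or_eq with he | he <;> simp [he, hn, hn.ne'] at h
    norm_num at h
  refine ⟨fun s => - u s, fun s => neg_pos.mpr ((hnonpos s).lt_of_ne (hne s)), fun f => ?_⟩
  simpa using hstat f

theorem sum_ite_lt_sum_ite {ι : Type*} [Fintype ι] {w : ι → ℝ} (hw : ∀ i, 0 < w i)
    {A B : ι → Prop} [DecidablePred A] [DecidablePred B] (hAB : ∀ i, A i → B i)
    (hBA : ∃ i, B i ∧ ¬ A i) :
    (∑ i, if A i then w i else 0) < ∑ i, if B i then w i else 0 := by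
  obtain ⟨j, hB, hA⟩ := hBA
  refine Finset.sum_lt_sum (fun i _ => ?_) ⟨j, Finset.mem_univ j, by simp [hA, hB, hw]⟩
  by_cases h : A i
  · simp [h, hAB i h]
  · have := (hw i).le
    split_ifs <;> simp_all

/-- The midpoints of the pairs `x m`, `x (m + L)` can be interleaved with the points of an
increasing sequence in any way compatible with the order: exactly the midpoints with `m < q j`
lie below `x j`. -/
theorem exists_interleaved_midpoints (M L : ℕ) (q : ℕ → ℕ) (hq : Monotone q)
    (hqM : ∀ i, q i ≤ M) (hqi : ∀ i < M + L, q i ≤ i) (hiq : ∀ i < M + L, i < q i + L) :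
    ∃ x : ℕ → ℝ, (∀ i j, i < j → j < M + L → x i < x j) ∧
      ∀ m < M, ∀ j < M + L, (q j ≤ m → 2 * x j < x m + x (m + L)) ∧
        (m < q j → x m + x (m + L) < 2 * x j) := by
  classical
  let S := {z : Fin (M + L + 1) × Fin (M + 1) //
    (∀ j < (z.1 : ℕ), q j ≤ z.2) ∧ (z.2 : ℕ) ≤ q z.1}
  obtain ⟨w, hw, hstat⟩ := exists_pos_stationary (σ := Fin (M + 1)) (ε := S × Bool)
    (fun e => e.1.1.2)
    (fun e => if e.2 then ⟨min e.1.1.1 M, by omega⟩ else ⟨(e.1.1.1 : ℕ) - L, by omega⟩) (by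
      intro Z hZ hcl
      have hup (i s : ℕ) (hi : i ≤ M + L) (hs : s ≤ M) (h1 : ∀ j < i, q j ≤ s) (h2 : s ≤ q i)
          (h : (⟨min i M, by omega⟩ : Fin (M + 1)) ∈ Z) :
          (⟨s, by omega⟩ : Fin (M + 1)) ∈ Z :=
        hcl (⟨(⟨i, by omega⟩, ⟨s, by omega⟩), h1, h2⟩, true) (by simpa using h)
      have hdown (i s : ℕ) (hi : i ≤ M + L) (hs : s ≤ M) (h1 : ∀ j < i, q j ≤ s) (h2 : s ≤ q i)
          (h : (⟨i - L, by omega⟩ : Fin (M + 1)) ∈ Z) :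
          (⟨s, by omega⟩ : Fin (M + 1)) ∈ Z :=
        hcl (⟨(⟨i, by omega⟩, ⟨s, by omega⟩), h1, h2⟩, false) (by simpa using h)
      have hzero (r : ℕ) : ∀ hr : r < M + 1, (⟨r, hr⟩ : Fin (M + 1)) ∈ Z →
          (⟨0, by omega⟩ : Fin (M + 1)) ∈ Z := by
        induction r using Nat.strong_induction_on with
        | _ r ih =>
          intro hr h
          rcases r with _ | r
          · exact h
          · have hqr : q r ≤ r := hqi r (by omega)
            refine ih (q r) (by omega) (by omega) ?_
            refine hup (r + 1) (q r) (by omega) (by omega) (fun j hj => hq (by omega))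
              (hq (by omega)) ?_
            simpa [Nat.min_eq_left (show r + 1 ≤ M by omega)] using h
      have hall (r : ℕ) : ∀ hr : r < M + 1, (⟨r, hr⟩ : Fin (M + 1)) ∈ Z := by
        induction r using Nat.strong_induction_on with
        | _ r ih =>
          intro hr
          rcases r with _ | r
          · obtain ⟨t, ht⟩ := hZ
            exact hzero t t.2 ht
          · have hex : ∃ i, r + 1 ≤ q i := ⟨r + L, by have := hiq (r + L) (by omega); omega⟩
            have hle : Nat.find hex ≤ r + L :=
              Nat.find_min' hex (by have := hiq (r + L) (by omega); omega)
            refine hdown (Nat.find hex) (r + 1) (by omega) (by omega) (fun j hj => ?_)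
              (Nat.find_spec hex) (ih _ (by omega) _)
            have := Nat.find_min hex hj
            omega
      exact fun s => hall s s.2)
  let x : ℕ → ℝ := fun j => ∑ z : S, if (z.1.1 : ℕ) ≤ j then w z.1.2 else 0
  let a : ℕ → ℝ := fun m => ∑ z : S, if (z.1.2 : ℕ) ≤ m then w z.1.2 else 0
  have hmid (m : ℕ) (hm : m < M) : x m + x (m + L) = 2 * a m := by
    have h := hstat fun s => if (s : ℕ) ≤ m then 1 else 0
    rw [Fintype.sum_prod_type] at h
    simp only [Fintype.sum_bool] at h
    rw [← sub_eq_zero, ← h]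
    simp only [x, a, Finset.mul_sum]
    rw [← Finset.sum_add_distrib, ← Finset.sum_sub_distrib]
    refine Finset.sum_congr rfl fun z _ => ?_
    have h1 : min (z.1.1 : ℕ) M ≤ m ↔ (z.1.1 : ℕ) ≤ m := by omega
    have h2 : (z.1.1 : ℕ) - L ≤ m ↔ (z.1.1 : ℕ) ≤ m + L := by omega
    simp only [if_true, Bool.false_eq_true, if_false, h1, h2]
    split_ifs <;> ring
  have hstate (i j : ℕ) (hi : i ≤ M + L) (h1 : ∀ l < i, q l ≤ q j) (h2 : q j ≤ q i) :
      ∃ z : S, (z.1.1 : ℕ) = i ∧ (z.1.2 : ℕ) = q j :=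
    ⟨⟨(⟨i, by omega⟩, ⟨q j, by have := hqM j; omega⟩), h1, h2⟩, rfl, rfl⟩
  refine ⟨x, fun i j hij hj => ?_, fun m hm j hj => ⟨fun h => ?_, fun h => ?_⟩⟩
  · obtain ⟨z, hz, -⟩ := hstate j j (by omega) (fun l hl => hq hl.le) le_rfl
    exact sum_ite_lt_sum_ite (fun z : S => hw z.1.2) (fun z hz => by omega)
      ⟨z, by omega, by omega⟩
  · rw [hmid m hm]
    obtain ⟨z, hz, hz'⟩ := hstate (j + 1) j (by omega) (fun l hl => hq (by omega))
      (hq (by omega))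
    have : x j < a m := sum_ite_lt_sum_ite (fun z : S => hw z.1.2)
      (fun z hz => (z.2.2.trans (hq hz)).trans h) ⟨z, by omega, by omega⟩
    linarith
  · rw [hmid m hm]
    obtain ⟨z, hz, hz'⟩ := hstate j j (by omega) (fun l hl => hq hl.le) le_rfl
    have : a m < x j := sum_ite_lt_sum_ite (fun z : S => hw z.1.2)
      (fun z hz => by
        by_contra! hlt
        have := z.2.1 j hlt
        omega) ⟨z, by omega, by omega⟩
    linarith


/-- Sufficiency of the block-structure condition: if a `k`-regular directed graph has
an ordering `v 0, …, v (n-1)` whose out-neighborhoods are monotone contiguous blocks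
`out[v i] = {v (p i), …, v (p i + k)}` with `p i ≤ i ≤ p i + k`, then there exist reals
`x 0 < ⋯ < x (n-1)` such that `v i ↦ x i` is a kNN-realization of `G` in `ℝ`. -/
theorem stmt_7 {V : Type} [Fintype V] (n k : ℕ) (E : V → V → Prop)
    (hirr : ∀ u : V, ¬ E u u)
    (hreg : ∀ u : V, {w : V | E u w}.ncard = k)
    (v : Fin n → V) (hv : Function.Bijective v)
    (p : Fin n → ℕ)
    (hrange : ∀ i : Fin n, p i + k < n)
    (hmono : Monotone p)
    (hsand : ∀ i : Fin n, p i ≤ (i : ℕ) ∧ (i : ℕ) ≤ p i + k)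
    (hblock : ∀ (i : Fin n) (x : V), (x = v i ∨ E (v i) x) ↔
      ∃ j : Fin n, p i ≤ (j : ℕ) ∧ (j : ℕ) ≤ p i + k ∧ x = v j) :
    ∃ x : Fin n → ℝ, StrictMono x ∧
      ∀ i j j' : Fin n, v i ≠ v j → v i ≠ v j' → v j ≠ v j' →
        E (v i) (v j) → ¬ E (v i) (v j') → |x i - x j| < |x i - x j'| := by
  rcases Nat.eq_zero_or_pos n with rfl | hn
  · exact ⟨fun _ => 0, fun i => i.elim0, fun i => i.elim0⟩
  obtain ⟨M, rfl⟩ : ∃ M, n = M + (k + 1) := by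
    have := hrange ⟨0, hn⟩
    exact ⟨n - (k + 1), by omega⟩
  let q : ℕ → ℕ := fun i => if h : i < M + (k + 1) then p ⟨i, h⟩ else M
  have hqp (i : Fin (M + (k + 1))) : q i = p i := by simp [q]
  have hqM (i : ℕ) : q i ≤ M := by
    by_cases h : i < M + (k + 1)
    · have := hrange ⟨i, h⟩
      simp only [q, h, dif_pos]
      omega
    · simp [q, h]
  have hq : Monotone q := by
    intro i j hij
    by_cases h : j < M + (k + 1)
    · have h' : i < M + (k + 1) := by omega
      simp only [q, h, h', dif_pos]
      exact hmono hij
    · exact (hqM i).trans_eq (by simp [q, h])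
  obtain ⟨x, hx, hmid⟩ := exists_interleaved_midpoints M (k + 1) q hq hqM
    (fun i hi => by have := hsand ⟨i, hi⟩; have := hqp ⟨i, hi⟩; simp_all)
    (fun i hi => by
      have h1 := (hsand ⟨i, hi⟩).2
      have h2 := hqp ⟨i, hi⟩
      simp only at h1 h2
      omega)
  have hle (i j : ℕ) (hij : i ≤ j) (hj : j < M + (k + 1)) : x i ≤ x j := by
    rcases hij.eq_or_lt with rfl | h
    · exact le_rfl
    · exact (hx i j h hj).le
  refine ⟨fun i => x i, fun i j hij => hx i j hij j.2, ?_⟩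
  intro i j j' _ hij' _ hE hE'
  obtain ⟨b, hb1, hb2, hb⟩ := (hblock i (v j)).mp (Or.inr hE)
  obtain rfl := hv.injective hb
  have hout : (j' : ℕ) < p i ∨ p i + k < j' := by
    by_contra! h
    rcases (hblock i (v j')).mpr ⟨j', h.1, h.2, rfl⟩ with h | h
    · exact hij' h.symm
    · exact hE' h
  have hi := hsand i
  have hr := hrange i
  have hj'2 := j'.2
  rcases hout with h | h
  · have hm := (hmid (p i - 1) (by omega) i i.2).2 (by rw [hqp]; omega)
    rw [show p i - 1 + (k + 1) = p i + k by omega] at hm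
    have h1 := hle j (p i + k) hb2 hr
    have h2 := hle j' (p i - 1) (by omega) (by omega)
    have h3 := hx j' j (by omega) j.2
    refine lt_of_lt_of_le ?_ (le_abs_self _)
    rw [abs_lt]
    constructor <;> linarith
  · have hm := (hmid (p i) (by omega) i i.2).1 (hqp i).le
    have h1 := hle (p i) j hb1 j.2
    have h2 := hle (p i + (k + 1)) j' (by omega) j'.2
    have h3 := hx j j' (by omega) j'.2
    refine lt_of_lt_of_le ?_ (neg_le_abs _)
    rw [abs_lt]
    constructor <;> linarith
end

section
/- Let n, k be positive integers and p_1 ≤ ⋯ ≤ p_n integers in [1, n−k] with p_i ≤ i ≤ p_i+k. Consider the system of strict linear inequalities in variables Δ_1,…,Δ_{n−1}: Δ_j > 0 for all j, and for every i ∈ [n]: Σ_{j=p_i}^{i−1} Δ_j < Σ_{j=i}^{p_i+k} Δ_j (when p_i + k ≤ n−1... i.e., whenever the right sum's index range is within [1,n−1]) and Σ_{j=p_i−1}^{i−1} Δ_j > Σ_{j=i}^{p_i+k−1} Δ_j (whenever p_i ≥ 2). This system always has a solution. -/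
/-- **Gordan's theorem**: a finite system of strict homogeneous linear inequalities is feasible
as soon as the only nonnegative linear relation between its rows is the trivial one. -/
theorem exists_pos_of_forall_nonneg_relation_trivial {ι κ : Type*} (t : Finset ι) (s : Finset κ)
    (A : ι → κ → ℝ)
    (h : ∀ w : ι → ℝ, (∀ i, 0 ≤ w i) → (∀ i ∉ t, w i = 0) →
      (∀ j ∈ s, ∑ i ∈ t, w i * A i j = 0) → ∀ i ∈ t, w i = 0) :
    ∃ y : κ → ℝ, ∀ i ∈ t, 0 < ∑ j ∈ s, A i j * y j := by
  classical
  let v : t → (s → ℝ) := fun i j => A i j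
  have hmem : (0 : s → ℝ) ∉ convexHull ℝ (Set.range v) := by
    intro h0
    obtain ⟨u, ⟨hu0, hu1⟩, hu⟩ : ∃ u : t → ℝ, ((∀ i, 0 ≤ u i) ∧ ∑ i, u i = 1) ∧
        ∑ i, u i • v i = 0 := by
      have hv : Set.range v = Set.image (Fintype.linearCombination ℝ v)
          (Set.range fun i : t => (Pi.single i 1 : t → ℝ)) := by
        rw [← Set.range_comp]
        congr 1
        ext1 i
        simp
      rw [hv, ← LinearMap.image_convexHull, convexHull_rangle_single_eq_stdSimplex] at h0
      obtain ⟨u, hu, h0⟩ := h0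
      exact ⟨u, hu, by rwa [Fintype.linearCombination_apply] at h0⟩
    have hw := h (fun i => if hi : i ∈ t then u ⟨i, hi⟩ else 0)
      (fun i => by split_ifs; exacts [hu0 _, le_rfl])
      (fun i hi => by simp [hi])
      (fun j hj => by
        have h3 := congrFun hu ⟨j, hj⟩
        simp only [Finset.sum_apply, Pi.smul_apply, smul_eq_mul, Pi.zero_apply, v] at h3
        rw [← Finset.sum_coe_sort, ← h3]
        simp)
    have h4 : ∀ i, u i = 0 := fun i => by simpa using hw i i.2
    simp [h4] at hu1
  obtain ⟨f, c, hc0, hc⟩ := geometric_hahn_banach_point_closed (convex_convexHull ℝ _)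
    ((Set.finite_range v).isClosed_convexHull ℝ) hmem
  rw [map_zero] at hc0
  refine ⟨fun j => if hj : j ∈ s then f (Pi.single ⟨j, hj⟩ 1) else 0, fun i hi => ?_⟩
  have h5 := hc0.trans (hc _ (subset_convexHull ℝ _ ⟨⟨i, hi⟩, rfl⟩))
  have h6 : f (v ⟨i, hi⟩) = ∑ j : s, A i j * f (Pi.single j 1) := by
    conv_lhs => rw [pi_eq_sum_univ' (v ⟨i, hi⟩), map_sum]
    simp [v]
  rw [← Finset.sum_coe_sort]
  simpa [h6] using h5

/-- The gap system admits no nontrivial nonnegative relation: `g`, `a` and `b` are the weights of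
the positivity, upper and lower constraints, and the hypothesis `hrel` says that the coefficient of
every gap in the weighted sum vanishes. -/
theorem gap_relation_trivial (n k : ℕ) (p : ℕ → ℕ)
    (hrange : ∀ i ∈ Finset.Icc 1 n, 1 ≤ p i ∧ p i ≤ n - k)
    (hsand : ∀ i ∈ Finset.Icc 1 n, p i ≤ i ∧ i ≤ p i + k)
    (hmono : ∀ i ∈ Finset.Icc 1 n, ∀ j ∈ Finset.Icc 1 n, i ≤ j → p i ≤ p j)
    (g a b : ℕ → ℝ) (hg : ∀ i, 0 ≤ g i) (ha : ∀ i, 0 ≤ a i) (hb : ∀ i, 0 ≤ b i)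
    (ha' : ∀ i, n - 1 < p i + k → a i = 0) (hb' : ∀ i, p i < 2 → b i = 0)
    (hrel : ∀ l ∈ Finset.Icc 1 (n - 1), g l + ∑ i ∈ Finset.Icc 1 n,
      (a i * ((if l ∈ Finset.Icc i (p i + k) then 1 else 0) -
          (if l ∈ Finset.Icc (p i) (i - 1) then 1 else 0)) +
        b i * ((if l ∈ Finset.Icc (p i - 1) (i - 1) then 1 else 0) -
          (if l ∈ Finset.Icc i (p i + k - 1) then 1 else 0))) = 0) :
    (∀ l ∈ Finset.Icc 1 (n - 1), g l = 0) ∧ ∀ i ∈ Finset.Icc 1 n, a i = 0 ∧ b i = 0 := by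
  simp only [Finset.mem_Icc] at *
  rcases Nat.eq_zero_or_pos n with rfl | hn
  · exact ⟨fun l hl => by omega, fun i hi => by omega⟩
  have hp1 := hrange 1 (by omega)
  have hp1' := hsand 1 (by omega)
  have hpn := hsand n (by omega)
  have hpn' := hrange n (by omega)
  let C : ℕ → ℝ := fun m => ∑ i ∈ Finset.Icc 1 n,
    (a i * (if p i ≤ m then 1 else 0) - b i * (if p i ≤ m + 1 then 1 else 0))
  let E : ℕ → ℕ → ℕ → ℝ := fun l m i =>
    a i * ((if i ≤ l then 1 else 0) - (if p i ≤ m then 1 else 0)) +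
      b i * ((if p i ≤ m + 1 then 1 else 0) - (if i ≤ l then 1 else 0))
  have hE : ∀ l m, 1 ≤ l → l + 1 ≤ n → p l ≤ m + 1 → m + 1 ≤ p (l + 1) →
      ∀ i ∈ Finset.Icc 1 n, 0 ≤ E l m i := by
    intro l m hl hln h1 h2 i hi
    rw [Finset.mem_Icc] at hi
    have h3 : i ≤ l → p i ≤ p l := hmono i hi l (by omega)
    have h4 : l + 1 ≤ i → p (l + 1) ≤ p i := hmono (l + 1) (by omega) i hi
    refine add_nonneg (mul_nonneg (ha i) ?_) (mul_nonneg (hb i) ?_)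
    · split_ifs <;> first | omega | norm_num
    · split_ifs <;> first | omega | norm_num
  have hC0 : C 0 = 0 := by
    refine Finset.sum_eq_zero fun i hi => ?_
    rw [Finset.mem_Icc] at hi
    have h1 := hrange i hi
    rw [if_neg (by omega)]
    split_ifs with h2
    · simp [hb' i (by omega)]
    · simp
  have hCtop : ∀ m, n - k ≤ m → C m = C (m - 1) := by
    intro m hm
    refine Finset.sum_congr rfl fun i hi => ?_
    rw [Finset.mem_Icc] at hi
    have h1 := hrange i hi
    rw [if_pos (show p i ≤ m by omega), if_pos (show p i ≤ m + 1 by omega),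
      if_pos (show p i ≤ m - 1 + 1 by omega)]
    split_ifs with h2
    · rfl
    · simp [ha' i (by omega)]
  have key : ∀ l m, 1 ≤ l → l + 1 ≤ n →
      g l + 2 * ∑ i ∈ Finset.Icc 1 n, E l m i + 2 * C m = C l + C (l - (k + 1)) := by
    intro l m hl hln
    have h1 := hrel l (by omega)
    rw [← sub_eq_zero, ← h1]
    simp only [C, E, Finset.mul_sum, add_assoc, add_sub_assoc]
    rw [add_right_inj, ← Finset.sum_add_distrib, ← Finset.sum_sub_distrib, ← Finset.sum_add_distrib]
    refine Finset.sum_congr rfl fun i hi => ?_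
    rw [Finset.mem_Icc] at hi
    have h2 := hrange i hi
    have h3 := hsand i hi
    have hA : ((if i ≤ l ∧ l ≤ p i + k then 1 else 0) - (if p i ≤ l ∧ l ≤ i - 1 then 1 else 0) : ℝ)
        = 2 * (if i ≤ l then 1 else 0) - (if p i ≤ l then 1 else 0)
          - (if p i ≤ l - (k + 1) then 1 else 0) := by
      split_ifs <;> first | omega | norm_num
    have hB : b i * ((if p i - 1 ≤ l ∧ l ≤ i - 1 then 1 else 0) -
          (if i ≤ l ∧ l ≤ p i + k - 1 then 1 else 0))
        = b i * ((if p i ≤ l + 1 then 1 else 0) + (if p i ≤ l - (k + 1) + 1 then 1 else 0)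
          - 2 * (if i ≤ l then 1 else 0)) := by
      by_cases h4 : p i < 2
      · simp [hb' i h4]
      · congr 1
        split_ifs <;> first | omega | norm_num
    rw [hA, hB]
    ring
  have hle : ∀ l m, 1 ≤ l → l + 1 ≤ n → p l ≤ m + 1 → m + 1 ≤ p (l + 1) →
      2 * C m ≤ C l + C (l - (k + 1)) := by
    intro l m hl hln h1 h2
    have h3 := Finset.sum_nonneg (hE l m hl hln h1 h2)
    linarith [key l m hl hln, hg l]
  obtain ⟨m₀, hm₀, hmax⟩ := Finset.exists_max_image (Finset.range n) C ⟨0, by simpa using hn⟩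
  simp only [Finset.mem_range] at hm₀ hmax
  have hmax0 : ∀ m < n, C m = C m₀ → C m₀ ≤ 0 := by
    intro m
    induction m using Nat.strong_induction_on with
    | _ m ih =>
      intro hm hCm
      rcases Nat.eq_zero_or_pos m with rfl | hpos
      · rw [← hCm, hC0]
      by_cases hmN : n - k ≤ m
      · exact ih (m - 1) (by omega) (by omega) ((hCtop m hmN).symm.trans hCm)
      · have hex : ∃ l, m + 1 ≤ p (l + 1) ∧ l + 1 ≤ n := ⟨n - 1, by
          rw [Nat.sub_add_cancel hn]; omega⟩
        classical
        obtain ⟨h1, h2⟩ := Nat.find_spec hex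
        have hmin := fun l => Nat.find_min hex (m := l)
        set l := Nat.find hex
        have hl : 1 ≤ l := by
          by_contra hl
          rw [show l = 0 by omega, zero_add] at h1
          omega
        have h3 : p l ≤ m := by
          have := hmin (l - 1) (by omega)
          rw [Nat.sub_add_cancel hl] at this
          omega
        have h4 := hsand l (by omega)
        have h5 := hle l m hl h2 (by omega) h1
        have h6 := hmax l (by omega)
        have h7 := hmax (l - (k + 1)) (by omega)
        exact ih (l - (k + 1)) (by omega) (by omega) (by linarith)
  have hCle : ∀ m < n, C m ≤ 0 := fun m hm => (hmax m hm).trans (hmax0 m₀ hm₀ rfl)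
  have hCge : ∀ m < n, 0 ≤ C m := by
    intro m
    induction m using Nat.strong_induction_on with
    | _ m ih =>
      intro hm
      rcases Nat.eq_zero_or_pos m with rfl | hpos
      · rw [hC0]
      have h1 := hrange m (by omega)
      have h2 := hsand m (by omega)
      have h3 := hmono m (by omega) (m + 1) (by omega) (by omega)
      have h4 := hle m (p m - 1) hpos hm (by omega) (by omega)
      linarith [ih (p m - 1) (by omega) (by omega), hCle (m - (k + 1)) (by omega)]
  have hC : ∀ m < n, C m = 0 := fun m hm => le_antisymm (hCle m hm) (hCge m hm)
  have hzero : ∀ l m, 1 ≤ l → l + 1 ≤ n → p l ≤ m + 1 → m + 1 ≤ p (l + 1) →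
      g l = 0 ∧ ∀ i ∈ Finset.Icc 1 n, E l m i = 0 := by
    intro l m hl hln h1 h2
    have h3 := hE l m hl hln h1 h2
    have h4 := Finset.sum_nonneg h3
    have h5 := key l m hl hln
    have h6 := hsand (l + 1) (by omega)
    rw [hC m (by omega), hC l (by omega), hC (l - (k + 1)) (by omega)] at h5
    have h7 := hg l
    exact ⟨by linarith, (Finset.sum_eq_zero_iff_of_nonneg h3).1 (by linarith)⟩
  refine ⟨fun l hl => ?_, fun i hi => ⟨?_, ?_⟩⟩
  · have h1 := hrange l (by omega)
    have h3 := hmono l (by omega) (l + 1) (by omega) (by omega)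
    exact (hzero l (p l - 1) hl.1 (by omega) (by omega) (by omega)).1
  · by_cases hin : i = n
    · exact ha' i (by subst hin; omega)
    have h1 := hrange i hi
    have h3 := hmono i hi (i + 1) (by omega) (by omega)
    have h4 := (hzero i (p i - 1) hi.1 (by omega) (by omega) (by omega)).2 i (Finset.mem_Icc.2 hi)
    simpa [E, show ¬ p i ≤ p i - 1 by omega, show p i ≤ p i - 1 + 1 by omega] using h4
  · by_cases hi1 : i = 1
    · exact hb' i (by subst hi1; omega)
    obtain ⟨l, rfl⟩ : ∃ l, i = l + 1 := ⟨i - 1, by omega⟩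
    have h1 := hrange (l + 1) hi
    have h3 := hmono l (by omega) (l + 1) hi (by omega)
    have h4 := (hzero l (p (l + 1) - 1) (by omega) hi.2 (by omega) (by omega)).2 (l + 1)
      (Finset.mem_Icc.2 hi)
    simpa [E, show ¬ p (l + 1) ≤ p (l + 1) - 1 by omega,
      show p (l + 1) ≤ p (l + 1) - 1 + 1 by omega] using h4


/-- Feasibility of the gap LP: given a monotone sequence `p` of indices in `[1, n-k]`
with `p i ≤ i ≤ p i + k`, the system of strict inequalities on gaps `Δ 1, …, Δ (n-1)`
(positivity, and for each `i` the two nearest-neighbor constraints) has a solution. -/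
theorem stmt_8 (n k : ℕ) (hk : 0 < k) (hn : 0 < n) (p : ℕ → ℕ)
    (hrange : ∀ i ∈ Finset.Icc 1 n, 1 ≤ p i ∧ p i ≤ n - k)
    (hsand : ∀ i ∈ Finset.Icc 1 n, p i ≤ i ∧ i ≤ p i + k)
    (hmono : ∀ i ∈ Finset.Icc 1 n, ∀ j ∈ Finset.Icc 1 n, i ≤ j → p i ≤ p j) :
    ∃ Δ : ℕ → ℝ, (∀ j ∈ Finset.Icc 1 (n - 1), 0 < Δ j) ∧
      ∀ i ∈ Finset.Icc 1 n,
        (p i + k ≤ n - 1 →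
          ∑ j ∈ Finset.Icc (p i) (i - 1), Δ j < ∑ j ∈ Finset.Icc i (p i + k), Δ j) ∧
        (2 ≤ p i →
          ∑ j ∈ Finset.Icc i (p i + k - 1), Δ j <
            ∑ j ∈ Finset.Icc (p i - 1) (i - 1), Δ j) := by
  let ind : Finset ℕ → ℕ → ℝ := fun S j => if j ∈ S then 1 else 0
  have hind : ∀ (S : Finset ℕ) (y : ℕ → ℝ), S ⊆ Finset.Icc 1 (n - 1) →
      ∑ j ∈ Finset.Icc 1 (n - 1), ind S j * y j = ∑ j ∈ S, y j := by
    intro S y hS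
    simp [ind, Finset.sum_ite_mem, Finset.inter_eq_right.2 hS]
  let U := (Finset.Icc 1 n).filter fun i => p i + k ≤ n - 1
  let L := (Finset.Icc 1 n).filter fun i => 2 ≤ p i
  let A : ℕ ⊕ (ℕ ⊕ ℕ) → ℕ → ℝ := Sum.elim (fun l => ind {l}) (Sum.elim
    (fun i j => ind (Finset.Icc i (p i + k)) j - ind (Finset.Icc (p i) (i - 1)) j)
    (fun i j => ind (Finset.Icc (p i - 1) (i - 1)) j - ind (Finset.Icc i (p i + k - 1)) j))
  obtain ⟨Δ, hΔ⟩ := exists_pos_of_forall_nonneg_relation_trivial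
    ((Finset.Icc 1 (n - 1)).disjSum (U.disjSum L)) (Finset.Icc 1 (n - 1)) A (by
      intro w hw hw' hrel
      have haU : ∀ i ∉ U, w (.inr (.inl i)) = 0 := fun i hi => hw' _ (by simpa using hi)
      have hbL : ∀ i ∉ L, w (.inr (.inr i)) = 0 := fun i hi => hw' _ (by simpa using hi)
      obtain ⟨hg, hab⟩ := gap_relation_trivial n k p hrange hsand hmono (fun i => w (.inl i))
        (fun i => w (.inr (.inl i))) (fun i => w (.inr (.inr i)))
        (fun i => hw _) (fun i => hw _) (fun i => hw _)
        (fun i hi => haU i (by simp only [U, Finset.mem_filter]; omega))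
        (fun i hi => hbL i (by simp only [L, Finset.mem_filter]; omega))
        (fun l hl => by
          refine Eq.trans ?_ (hrel l hl)
          rw [Finset.sum_disjSum, Finset.sum_disjSum, Finset.sum_add_distrib]
          congr 1
          · simp only [A, ind, Sum.elim_inl, Finset.mem_singleton, mul_ite, mul_one, mul_zero]
            rw [Finset.sum_ite_eq, if_pos hl]
          congr 1
          · exact (Finset.sum_subset (Finset.filter_subset _ _)
              fun i _ hi => by simp only [haU i hi, zero_mul]).symm
          · exact (Finset.sum_subset (Finset.filter_subset _ _)
              fun i _ hi => by simp only [hbL i hi, zero_mul]).symm)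
      rintro (l | i | i) hi
      · exact hg l (by simpa using hi)
      · exact (hab i (Finset.filter_subset _ _ (show i ∈ U by simpa using hi))).1
      · exact (hab i (Finset.filter_subset _ _ (show i ∈ L by simpa using hi))).2)
  refine ⟨Δ, fun j hj => ?_, fun i hi => ⟨fun hik => ?_, fun hik => ?_⟩⟩
  · have h1 := hΔ (.inl j) (by simpa using hj)
    simp only [A, Sum.elim_inl] at h1
    rwa [hind _ _ (by simpa using hj), Finset.sum_singleton] at h1
  all_goals
    have h2 := hrange i hi
    have h3 := hsand i hi
    have hi' := Finset.mem_Icc.1 hi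
  · have h1 := hΔ (.inr (.inl i)) (by simp [U, hi, hik])
    simp only [A, Sum.elim_inl, Sum.elim_inr, sub_mul, Finset.sum_sub_distrib] at h1
    rwa [hind _ _ (Finset.Icc_subset_Icc (by omega) (by omega)),
      hind _ _ (Finset.Icc_subset_Icc (by omega) (by omega)), sub_pos] at h1
  · have h1 := hΔ (.inr (.inr i)) (by simp [L, hi, hik])
    simp only [A, Sum.elim_inr, sub_mul, Finset.sum_sub_distrib] at h1
    rwa [hind _ _ (Finset.Icc_subset_Icc (by omega) (by omega)),
      hind _ _ (Finset.Icc_subset_Icc (by omega) (by omega)), sub_pos] at h1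
end

section
/- Fix d ≥ 1 and real ε with 0 < ε ≤ 1. Suppose f: ℕ → ℝ satisfies: f(m) = 0 for m ≤ δ, and for m > δ, f(m) ≤ m^{1−1/(2d)} + max Σ_{i=1}^r f(n_i) over all partitions n_1 + ⋯ + n_r = m with each n_i ≤ m/2. Assume δ is large enough that ε·(2^{1/(3d)} − 1)·m^{1−1/(3d)} ≥ m^{1−1/(2d)} for all m > δ. Then f(m) ≤ ε·(m − m^{1−1/(3d)}) for all m, and in particular f(m) ≤ ε·m. -/
/-- A function dominated by a linear function on the members of a multiset of naturals has its sum
dominated by the same linear function of the total. -/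
lemma Multiset.sum_map_le_natCast_sum_mul (l : Multiset ℕ) (f : ℕ → ℝ) (c : ℝ)
    (h : ∀ x ∈ l, f x ≤ (x : ℝ) * c) : (l.map f).sum ≤ (l.sum : ℝ) * c := by
  refine (Multiset.sum_map_le_sum_map f (fun x : ℕ => (x : ℝ) * c) h).trans_eq ?_
  rw [Multiset.sum_map_mul_right, Nat.cast_multiset_sum]

lemma Real.mul_two_rpow_mul_rpow_neg_le {a x m : ℝ} (ha : 0 ≤ a) (hx : 0 < x) (hxm : 2 * x ≤ m) :
    x * ((2 : ℝ) ^ a * m ^ (-a)) ≤ x ^ (1 - a) := by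
  have h : m ^ (-a) ≤ (2 * x) ^ (-a) :=
    Real.rpow_le_rpow_of_nonpos (by positivity) hxm (neg_nonpos.mpr ha)
  calc x * ((2 : ℝ) ^ a * m ^ (-a)) ≤ x * ((2 : ℝ) ^ a * (2 * x) ^ (-a)) := by gcongr
    _ = x ^ (1 - a) := by
      rw [Real.mul_rpow zero_le_two hx.le, ← mul_assoc ((2 : ℝ) ^ a), ← Real.rpow_add two_pos,
        add_neg_cancel, Real.rpow_zero, one_mul, sub_eq_add_neg, Real.rpow_add hx, Real.rpow_one]

lemma Real.natCast_rpow_one_sub_le {a : ℝ} (ha : 0 ≤ a) (ha' : a < 1) (m : ℕ) :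
    (m : ℝ) ^ (1 - a) ≤ m := by
  rcases Nat.eq_zero_or_pos m with rfl | hm
  · simp [Real.zero_rpow (sub_pos.mpr ha').ne']
  · exact Real.rpow_le_self_of_one_le (by exact_mod_cast hm) (by linarith)

/-- The recursive charging argument: if `f` vanishes up to threshold `δ`, satisfies the
recursive bound via balanced partitions above `δ`, and `δ` is large enough, then
`f m ≤ ε (m - m^(1-1/(3d)))`, and in particular `f m ≤ ε m`, for all `m`. -/
theorem stmt_14 (d : ℕ) (hd : 1 ≤ d) (ε : ℝ) (hε0 : 0 < ε) (hε1 : ε ≤ 1)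
    (δ : ℕ) (hδ : 0 < δ) (f : ℕ → ℝ)
    (hbase : ∀ m : ℕ, m ≤ δ → f m = 0)
    (hrec : ∀ m : ℕ, δ < m → ∃ l : Multiset ℕ,
      (∀ x ∈ l, 0 < x ∧ 2 * x ≤ m) ∧ l.sum = m ∧
      f m ≤ (m : ℝ) ^ (1 - 1 / (2 * (d : ℝ))) + (l.map f).sum)
    (hδbig : ∀ m : ℕ, δ < m →
      (m : ℝ) ^ (1 - 1 / (2 * (d : ℝ))) ≤
        ε * ((2 : ℝ) ^ (1 / (3 * (d : ℝ))) - 1) * (m : ℝ) ^ (1 - 1 / (3 * (d : ℝ)))) :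
    ∀ m : ℕ, f m ≤ ε * ((m : ℝ) - (m : ℝ) ^ (1 - 1 / (3 * (d : ℝ)))) ∧
      f m ≤ ε * (m : ℝ) := by
  have hd' : (1 : ℝ) ≤ d := by exact_mod_cast hd
  set a : ℝ := 1 / (3 * (d : ℝ)) with ha_def
  have ha : 0 ≤ a := by positivity
  have ha' : a < 1 := by
    rw [ha_def, div_lt_one (by positivity)]
    linarith
  have main : ∀ m : ℕ, f m ≤ ε * ((m : ℝ) - (m : ℝ) ^ (1 - a)) := by
    intro m
    induction m using Nat.strong_induction_on with
    | _ m ih =>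
      rcases le_or_gt m δ with hm | hm
      · rw [hbase m hm]
        exact mul_nonneg hε0.le (sub_nonneg.mpr (Real.natCast_rpow_one_sub_le ha ha' m))
      · obtain ⟨l, hl, hsum, hf⟩ := hrec m hm
        have hm0 : (0 : ℝ) < m := by exact_mod_cast hδ.trans hm
        have hparts := l.sum_map_le_natCast_sum_mul f (ε * (1 - (2 : ℝ) ^ a * (m : ℝ) ^ (-a)))
          fun x hx => by
            obtain ⟨hx0, hxm⟩ := hl x hx
            have hle := Real.mul_two_rpow_mul_rpow_neg_le ha
              (show (0 : ℝ) < x by exact_mod_cast hx0)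
              (show 2 * (x : ℝ) ≤ m by exact_mod_cast hxm)
            calc f x ≤ ε * ((x : ℝ) - (x : ℝ) ^ (1 - a)) := ih x (by omega)
              _ ≤ ε * ((x : ℝ) - x * ((2 : ℝ) ^ a * (m : ℝ) ^ (-a))) := by gcongr
              _ = x * (ε * (1 - (2 : ℝ) ^ a * (m : ℝ) ^ (-a))) := by ring
        have hpow : (m : ℝ) ^ (1 - a) = m * (m : ℝ) ^ (-a) := by
          rw [sub_eq_add_neg, Real.rpow_add hm0, Real.rpow_one]
        have hbig := hδbig m hm
        rw [hsum] at hparts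
        rw [hpow] at hbig ⊢
        linarith
  refine fun m => ⟨main m, (main m).trans ?_⟩
  gcongr
  exact sub_le_self _ (by positivity)
end
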